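/- For all real numbers t, t₁, t₂ one has the identity (1/4) · Σ_{(ε₁,ε₂,ε₃) ∈ {−1,1}³} |ε₁ t₁ + ε₂ t₂ + ε₃ t| = |t₁| + |t₂| + |t| + Ω(t, t₁, t₂). -/

import Mathlib

open Finset

/-- `Ω(t, t₁, t₂) := max{|t₁| − |t₂| − |t|, |t₂| − |t₁| − |t|, |t| − |t₁| − |t₂|, 0}`. -/
noncomputable def Omega (t t₁ t₂ : ℝ) : ℝ :=
  max (max (|t₁| - |t₂| - |t|) (|t₂| - |t₁| - |t|)) (max (|t| - |t₁| - |t₂|) 0)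

/-- The sum of the `|± a ± b + c|` for nonnegative `a`, `b`, `c`. -/
lemma sum_signed_abs_of_nonneg {a b c : ℝ} (ha : 0 ≤ a) (hb : 0 ≤ b) (hc : 0 ≤ c) :
    |a + b + c| + |a + b - c| + |a - b + c| + |a - b - c| =
      2 * (a + b + c + max (max (a - b - c) (b - a - c)) (max (c - a - b) 0)) := by
  rw [abs_of_nonneg (by positivity : 0 ≤ a + b + c)]
  rcases abs_cases (a + b - c) with h₁ | h₁ <;> rcases abs_cases (a - b + c) with h₂ | h₂ <;>
    rcases abs_cases (a - b - c) with h₃ | h₃ <;> grind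

lemma sum_signed_abs_eq (a b c : ℝ) :
    |a + b + c| + |a + b - c| + |a - b + c| + |a - b - c| =
      2 * (|a| + |b| + |c| + Omega c a b) := by
  rw [Omega, ← sum_signed_abs_of_nonneg (abs_nonneg a) (abs_nonneg b) (abs_nonneg c)]
  rcases abs_choice a with ha | ha <;> rcases abs_choice b with hb | hb <;>
    rcases abs_choice c with hc | hc <;> rw [ha, hb, hc] <;> grind

theorem quarter_sum_of_signed_abs_eq (t t₁ t₂ : ℝ) :
    (1 / 4 : ℝ) *
      ∑ ε ∈ ({-1, 1} : Finset ℝ) ×ˢ (({-1, 1} : Finset ℝ) ×ˢ ({-1, 1} : Finset ℝ)),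
        |ε.1 * t₁ + ε.2.1 * t₂ + ε.2.2 * t|
      = |t₁| + |t₂| + |t| + Omega t t₁ t₂ := by
  have h : (-1 : ℝ) ≠ 1 := by norm_num
  simp only [Finset.sum_product, Finset.sum_pair h]
  have key := sum_signed_abs_eq t₁ t₂ t
  have e₁ : |-1 * t₁ + -1 * t₂ + -1 * t| = |t₁ + t₂ + t| := by rw [← abs_neg]; ring_nf
  have e₂ : |-1 * t₁ + -1 * t₂ + 1 * t| = |t₁ + t₂ - t| := by rw [← abs_neg]; ring_nf
  have e₃ : |-1 * t₁ + 1 * t₂ + -1 * t| = |t₁ - t₂ + t| := by rw [← abs_neg]; ring_nf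
  have e₄ : |-1 * t₁ + 1 * t₂ + 1 * t| = |t₁ - t₂ - t| := by rw [← abs_neg]; ring_nf
  have e₅ : |1 * t₁ + -1 * t₂ + -1 * t| = |t₁ - t₂ - t| := by ring_nf
  have e₆ : |1 * t₁ + -1 * t₂ + 1 * t| = |t₁ - t₂ + t| := by ring_nf
  have e₇ : |1 * t₁ + 1 * t₂ + -1 * t| = |t₁ + t₂ - t| := by ring_nf
  have e₈ : |1 * t₁ + 1 * t₂ + 1 * t| = |t₁ + t₂ + t| := by ring_nf
  rw [e₁, e₂, e₃, e₄, e₅, e₆, e₇, e₈]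
  linarith
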